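/- arXiv:1101.4255 — 3 statements merged into one kernel-verified Lean document; each statement's English description precedes it below -/
import Mathlib

section
/- Let A and B be nonzero polynomials with integer coefficients such that all the nonzero coefficients of A have the same sign and all the nonzero coefficients of B have the same sign. Then g(A·B) ≤ min{u, v}, where u = max{ g(B), g(A) + tdeg(B) - deg(B) } and v = max{ g(A), g(B) + tdeg(A) - deg(A) }, the quantities being computed in the integers. -/
open Polynomial

/-- The maximum gap `g(f)` between consecutive exponents occurring in a polynomial:
for `f = c₁x^{e₁} + ⋯ + cₜx^{eₜ}` with `cᵢ ≠ 0` and `e₁ < ⋯ < eₜ`, this is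
`max_{1 ≤ i < t} (e_{i+1} - e_i)`, and `0` when `t = 1`. -/
noncomputable def maxGap (f : Polynomial ℤ) : ℕ :=
  (((f.support.sort (· ≤ ·)).zip (f.support.sort (· ≤ ·)).tail).map
    (fun p => p.2 - p.1)).foldr max 0

/-- The differences of consecutive entries of a strictly increasing list are all at most `m` exactly
when every entry that is not the last one has another entry at most `m` above it. -/
lemma foldr_max_consecutive_sub_le_iff (m : ℕ) (l : List ℕ) (hl : l.Pairwise (· < ·)) :
    ((l.zip l.tail).map (fun p => p.2 - p.1)).foldr max 0 ≤ m ↔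
      ∀ x ∈ l, ∀ z ∈ l, x < z → ∃ y ∈ l, x < y ∧ y ≤ x + m := by
  induction l with
  | nil => simp
  | cons a t ih =>
    cases t with
    | nil => simp
    | cons b t =>
      have ih := ih hl.of_cons
      have ha : ∀ y ∈ b :: t, a < y := (List.pairwise_cons.1 hl).1
      have hb : ∀ y ∈ t, b < y := (List.pairwise_cons.1 hl.of_cons).1
      simp only [List.tail_cons, List.zip_cons_cons, List.map_cons, List.foldr_cons,
        max_le_iff] at ih ⊢
      rw [ih]
      constructor
      · rintro ⟨hab, h⟩ x hx z hz hxz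
        rcases List.mem_cons.1 hx with rfl | hxt
        · exact ⟨b, by simp, ha b (by simp), by omega⟩
        · rcases List.mem_cons.1 hz with rfl | hzt
          · have := ha x hxt
            omega
          · obtain ⟨y, hy, h'⟩ := h x hxt z hzt hxz
            exact ⟨y, List.mem_cons_of_mem _ hy, h'⟩
      · intro h
        constructor
        · obtain ⟨y, hy, hay, hym⟩ := h a (by simp) b (by simp) (ha b (by simp))
          rcases List.mem_cons.1 hy with rfl | hy
          · omega
          · rcases List.mem_cons.1 hy with rfl | hy
            · omega
            · have := hb y hy
              omega
        · intro x hx z hz hxz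
          obtain ⟨y, hy, hxy, hym⟩ :=
            h x (List.mem_cons_of_mem _ hx) z (List.mem_cons_of_mem _ hz) hxz
          rcases List.mem_cons.1 hy with rfl | hy
          · have := ha x hx
            omega
          · exact ⟨y, hy, hxy, hym⟩

lemma maxGap_le_iff (f : ℤ[X]) (m : ℕ) :
    maxGap f ≤ m ↔
      ∀ x ∈ f.support, ∀ z ∈ f.support, x < z → ∃ y ∈ f.support, x < y ∧ y ≤ x + m := by
  rw [maxGap]
  simpa only [Finset.mem_sort] using
    foldr_max_consecutive_sub_le_iff m (f.support.sort (· ≤ ·)) f.support.sortedLT_sort.pairwise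

lemma exists_mem_support_le_add_maxGap {f : ℤ[X]} {x z : ℕ} (hx : x ∈ f.support)
    (hz : z ∈ f.support) (hxz : x < z) : ∃ y ∈ f.support, x < y ∧ y ≤ x + maxGap f :=
  (maxGap_le_iff f _).1 le_rfl x hx z hz hxz

/-- If no cancellation is possible, exponents of the factors add up to exponents of the product. -/
lemma add_mem_support_mul {A B : ℤ[X]}
    (hsA : (∀ k, 0 ≤ A.coeff k) ∨ (∀ k, A.coeff k ≤ 0))
    (hsB : (∀ k, 0 ≤ B.coeff k) ∨ (∀ k, B.coeff k ≤ 0))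
    {a b : ℕ} (ha : a ∈ A.support) (hb : b ∈ B.support) : a + b ∈ (A * B).support := by
  have hne : A.coeff a * B.coeff b ≠ 0 := mul_ne_zero (mem_support_iff.1 ha) (mem_support_iff.1 hb)
  have hmem : (a, b) ∈ Finset.HasAntidiagonal.antidiagonal (a + b) := by simp
  have key : (∀ i j, 0 ≤ A.coeff i * B.coeff j) ∨ (∀ i j, A.coeff i * B.coeff j ≤ 0) := by
    rcases hsA with hA | hA <;> rcases hsB with hB | hB
    · exact .inl fun i j => mul_nonneg (hA i) (hB j)
    · exact .inr fun i j => mul_nonpos_of_nonneg_of_nonpos (hA i) (hB j)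
    · exact .inr fun i j => mul_nonpos_of_nonpos_of_nonneg (hA i) (hB j)
    · exact .inl fun i j => mul_nonneg_of_nonpos_of_nonpos (hA i) (hB j)
  rw [mem_support_iff, coeff_mul]
  intro h0
  rcases key with h | h
  · exact hne ((Finset.sum_eq_zero_iff_of_nonneg fun p _ => h p.1 p.2).1 h0 _ hmem)
  · exact hne ((Finset.sum_eq_zero_iff_of_nonpos fun p _ => h p.1 p.2).1 h0 _ hmem)

lemma exists_add_eq_of_mem_support_mul {A B : ℤ[X]} {n : ℕ} (hn : n ∈ (A * B).support) :
    ∃ a ∈ A.support, ∃ b ∈ B.support, a + b = n := by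
  rw [mem_support_iff, coeff_mul] at hn
  obtain ⟨⟨a, b⟩, hp, hne⟩ := Finset.exists_ne_zero_of_sum_ne_zero hn
  exact ⟨a, mem_support_iff.2 (left_ne_zero_of_mul hne), b,
    mem_support_iff.2 (right_ne_zero_of_mul hne), Finset.HasAntidiagonal.mem_antidiagonal.1 hp⟩

lemma maxGap_mul_le_max (A B : ℤ[X]) (hB : B ≠ 0)
    (hsA : (∀ k, 0 ≤ A.coeff k) ∨ (∀ k, A.coeff k ≤ 0))
    (hsB : (∀ k, 0 ≤ B.coeff k) ∨ (∀ k, B.coeff k ≤ 0)) :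
    (maxGap (A * B) : ℤ) ≤
      max (maxGap B : ℤ) ((maxGap A : ℤ) + B.natTrailingDegree - B.natDegree) := by
  have hdB := natDegree_mem_support_of_nonzero hB
  have htB := natTrailingDegree_mem_support_of_nonzero hB
  have hle := natTrailingDegree_le_natDegree B
  suffices h : maxGap (A * B) ≤ max (maxGap B)
      (maxGap A + B.natTrailingDegree - B.natDegree) by omega
  rw [maxGap_le_iff]
  intro x hx z hz hxz
  obtain ⟨a, ha, b, hb, rfl⟩ := exists_add_eq_of_mem_support_mul hx
  obtain ⟨c, hc, d, hd, rfl⟩ := exists_add_eq_of_mem_support_mul hz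
  have hbd := le_natDegree_of_mem_supp b hb
  have hdd := le_natDegree_of_mem_supp d hd
  rcases hbd.lt_or_eq with hlt | rfl
  · obtain ⟨y, hy, hby, hyb⟩ := exists_mem_support_le_add_maxGap hb hdB hlt
    exact ⟨a + y, add_mem_support_mul hsA hsB ha hy, by omega, by omega⟩
  · obtain ⟨a', ha', haa', ha'a⟩ := exists_mem_support_le_add_maxGap ha hc (by omega)
    by_cases hcase : a + B.natDegree < a' + B.natTrailingDegree
    · exact ⟨_, add_mem_support_mul hsA hsB ha' htB, hcase, by omega⟩
    · obtain ⟨e, he, hmax⟩ := (B.support.filter fun e => a' + e ≤ a + B.natDegree).exists_max_image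
        id ⟨B.natTrailingDegree, Finset.mem_filter.2 ⟨htB, by omega⟩⟩
      obtain ⟨he, hea⟩ := Finset.mem_filter.1 he
      obtain ⟨y, hy, hey, hye⟩ := exists_mem_support_le_add_maxGap he hdB (by omega)
      refine ⟨a' + y, add_mem_support_mul hsA hsB ha' hy, ?_, by omega⟩
      by_contra hcon
      have := hmax y (Finset.mem_filter.2 ⟨hy, by omega⟩)
      simp only [id] at this
      omega

theorem maxGap_mul_le (A B : Polynomial ℤ) (hA : A ≠ 0) (hB : B ≠ 0)
    (hsA : (∀ k, 0 ≤ A.coeff k) ∨ (∀ k, A.coeff k ≤ 0))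
    (hsB : (∀ k, 0 ≤ B.coeff k) ∨ (∀ k, B.coeff k ≤ 0)) :
    (maxGap (A * B) : ℤ) ≤
      min (max (maxGap B : ℤ)
            ((maxGap A : ℤ) + B.natTrailingDegree - B.natDegree))
          (max (maxGap A : ℤ)
            ((maxGap B : ℤ) + A.natTrailingDegree - A.natDegree)) := by
  refine le_min (maxGap_mul_le_max A B hB hsA hsB) ?_
  rw [mul_comm]
  exact maxGap_mul_le_max B A hA hsB hsA
end

section
/- Let p1 < p2 be odd primes. Then g(Φ_{p1p2}) ≥ p1 - 1. -/
open Polynomial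

theorem List.sub_le_foldr_max_gap {a b c : ℕ} (hab : a < b) :
    ∀ l : List ℕ, l.Pairwise (· < ·) → a ∈ l → b ∈ l → (∀ x ∈ l, a < x → c ≤ x) →
      c - a ≤ ((l.zip l.tail).map (fun p => p.2 - p.1)).foldr max 0
  | [], _, ha, _, _ => by simp at ha
  | [x], _, ha, hb, _ => by
    simp only [List.mem_singleton] at ha hb
    omega
  | x :: y :: t, hl, ha, hb, hc => by
    obtain ⟨hx, ht⟩ := List.pairwise_cons.1 hl
    simp only [List.tail_cons, List.zip_cons_cons, List.map_cons, List.foldr_cons]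
    rcases List.mem_cons.1 ha with rfl | ha'
    · have hy := hc y (by simp) (hx y (by simp))
      exact le_max_of_le_left (by omega)
    · have hxa := hx a ha'
      have hb' : b ∈ y :: t := (List.mem_cons.1 hb).resolve_left (by omega)
      exact le_max_of_le_right (List.sub_le_foldr_max_gap hab (y :: t) ht ha' hb'
        fun z hz => hc z (List.mem_cons_of_mem _ hz))

theorem sub_le_maxGap {f : ℤ[X]} {a b c : ℕ} (hab : a < b) (ha : f.coeff a ≠ 0)
    (hb : f.coeff b ≠ 0) (hc : ∀ k, a < k → k < c → f.coeff k = 0) : c - a ≤ maxGap f := by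
  refine List.sub_le_foldr_max_gap hab _ f.support.sortedLT_sort.pairwise
    (by simpa using ha) (by simpa using hb) fun x hx hax => ?_
  by_contra! hxc
  exact (by simpa using hx : f.coeff x ≠ 0) (hc x hax hxc)

theorem cyclotomic_mul_X_pow_sub_one {p q : ℕ} (hp : p.Prime) (hq : q.Prime) (hpq : p ≠ q) :
    cyclotomic (p * q) ℤ * (X ^ p - 1) = expand ℤ q (cyclotomic p ℤ) * (X - 1) := by
  have := Fact.mk hp
  rw [cyclotomic_expand_eq_cyclotomic_mul hq
    (fun h => hpq ((Nat.prime_dvd_prime_iff_eq hq hp).1 h).symm), mul_assoc,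
    cyclotomic_prime_mul_X_sub_one]

theorem coeff_cyclotomic_mul_succ {p q k : ℕ} (hp : p.Prime) (hq : q.Prime) (hpq : p < q)
    (hk : k + 1 < p) : (cyclotomic (p * q) ℤ).coeff (k + 1) = if k = 0 then -1 else 0 := by
  have h := congrArg (fun f => f.coeff (k + 1)) (cyclotomic_mul_X_pow_sub_one hp hq hpq.ne)
  simp only [mul_sub, mul_one, coeff_sub, coeff_mul_X_pow', coeff_mul_X,
    coeff_expand hq.pos, if_neg (not_le.2 hk),
    if_neg (Nat.not_dvd_of_pos_of_lt k.succ_pos (hk.trans hpq))] at h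
  split_ifs with hk0
  · subst hk0
    simp only [zero_add, dvd_zero, if_true, Nat.zero_div, cyclotomic_coeff_zero ℤ hp.one_lt] at h ⊢
    omega
  · rw [if_neg (Nat.not_dvd_of_pos_of_lt (Nat.pos_of_ne_zero hk0) (by omega))] at h
    omega

theorem maxGap_cyclotomic_two_primes_ge (p1 p2 : ℕ) (hp1 : p1.Prime) (hp2 : p2.Prime)
    (hodd1 : Odd p1) (hodd2 : Odd p2) (hlt : p1 < p2) :
    p1 - 1 ≤ maxGap (cyclotomic (p1 * p2) ℤ) := by
  have h3 : 3 ≤ p1 := by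
    have := hp1.two_le
    obtain ⟨k, rfl⟩ := hodd1
    omega
  refine sub_le_maxGap (b := (cyclotomic (p1 * p2) ℤ).natDegree) ?_ ?_ ?_ ?_
  · rw [natDegree_cyclotomic, Nat.totient_mul ((Nat.coprime_primes hp1 hp2).2 hlt.ne),
      Nat.totient_prime hp1, Nat.totient_prime hp2]
    exact Nat.one_lt_mul_iff.2 (by omega)
  · have := coeff_cyclotomic_mul_succ (k := 0) hp1 hp2 hlt (by omega)
    simp_all
  · rw [coeff_natDegree, (cyclotomic.monic _ ℤ).leadingCoeff]
    exact one_ne_zero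
  · rintro (_ | k) hk hkp
    · omega
    · rw [coeff_cyclotomic_mul_succ hp1 hp2 hlt hkp, if_neg (by omega)]
end

section
/- Let n = p1·p2·p3 where p1 < p2 < p3 are odd primes satisfying 2n/p1 > (4/3)·deg(Ψ_n), i.e., 6·p2·p3 > 4·deg(Ψ_n). Then g(Ψ_n) = 2n/p1 - deg(Ψ_n) = 2·p2·p3 - deg(Ψ_n). -/
open Polynomial

/-- The `n`-th inverse cyclotomic polynomial `Ψₙ(x) = (xⁿ - 1)/Φₙ(x)`. -/
noncomputable def invCyclotomic (n : ℕ) : Polynomial ℤ :=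
  (X ^ n - 1) /ₘ cyclotomic n ℤ

theorem List.foldr_max_le {l : List ℕ} {k : ℕ} (h : ∀ a ∈ l, a ≤ k) : l.foldr max 0 ≤ k := by
  induction l with
  | nil => simp
  | cons a l ih => simp_all

theorem List.le_foldr_max {l : List ℕ} {a : ℕ} (h : a ∈ l) : a ≤ l.foldr max 0 := by
  induction l with
  | nil => simp at h
  | cons b l ih => grind

/-- In a strictly increasing list, the members of `l.zip l.tail` are the pairs `a < b` of entries
with no entry strictly in between. -/
theorem List.Pairwise.mem_zip_tail_iff {α : Type*} [LinearOrder α] {l : List α}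
    (hl : l.Pairwise (· < ·)) {a b : α} :
    (a, b) ∈ l.zip l.tail ↔ a ∈ l ∧ b ∈ l ∧ a < b ∧ ∀ c ∈ l, c ≤ a ∨ b ≤ c := by
  induction l with
  | nil => simp
  | cons x l ih =>
    cases l with
    | nil =>
      simp only [List.tail_cons, List.zip_nil_right, List.not_mem_nil, List.mem_singleton,
        false_iff]
      rintro ⟨rfl, rfl, h, -⟩
      exact lt_irrefl _ h
    | cons y l =>
      have hx : ∀ c ∈ y :: l, x < c := (List.pairwise_cons.1 hl).1
      have hy : ∀ c ∈ l, y < c := (List.pairwise_cons.1 (List.pairwise_cons.1 hl).2).1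
      specialize ih (List.pairwise_cons.1 hl).2
      simp only [List.tail_cons, List.zip_cons_cons, List.mem_cons, Prod.mk.injEq] at ih ⊢ hx
      rw [ih]
      constructor
      · rintro (⟨rfl, rfl⟩ | ⟨ha, hb, hab, h⟩) <;> grind
      · rintro ⟨ha, hb, hab, h⟩
        have := h y (.inr (.inl rfl))
        grind

/-- The maximum gap is the largest difference of two consecutive exponents. -/
theorem maxGap_eq_of_forall_le {f : ℤ[X]} {a b : ℕ} (ha : a ∈ f.support) (hb : b ∈ f.support)
    (hab : a < b) (hcons : ∀ c ∈ f.support, c ≤ a ∨ b ≤ c)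
    (hmax : ∀ u ∈ f.support, ∀ v ∈ f.support, u < v → (∀ c ∈ f.support, c ≤ u ∨ v ≤ c) →
      v - u ≤ b - a) : maxGap f = b - a := by
  have hl : (f.support.sort (· ≤ ·)).Pairwise (· < ·) := (Finset.sortedLT_sort _).pairwise
  apply le_antisymm
  · refine List.foldr_max_le fun k hk => ?_
    obtain ⟨⟨u, v⟩, huv, rfl⟩ := List.mem_map.1 hk
    obtain ⟨hu, hv, h, hc⟩ := hl.mem_zip_tail_iff.1 huv
    simp only [Finset.mem_sort] at hu hv hc
    exact hmax u hu v hv h hc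
  · refine List.le_foldr_max (List.mem_map.2 ⟨(a, b), hl.mem_zip_tail_iff.2 ?_, rfl⟩)
    simpa only [Finset.mem_sort] using ⟨ha, hb, hab, hcons⟩

theorem maxGap_X_pow_sub_one_mul {f : ℤ[X]} {m : ℕ} (h0 : f.coeff 0 ≠ 0)
    (hm : 2 * f.natDegree < m) : maxGap ((X ^ m - 1) * f) = m - f.natDegree := by
  have hf : f ≠ 0 := by rintro rfl; simp at h0
  have hcoeff (k : ℕ) : ((X ^ m - 1) * f).coeff k =
      (if m ≤ k then f.coeff (k - m) else 0) - f.coeff k := by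
    rw [sub_mul, one_mul, coeff_sub, coeff_X_pow_mul']
  have hzero {k : ℕ} (hk : f.natDegree < k) : f.coeff k = 0 := coeff_eq_zero_of_natDegree_lt hk
  have hsupp {k : ℕ} (hk : k ∈ ((X ^ m - 1) * f).support) :
      k ≤ f.natDegree ∨ m ≤ k ∧ k ≤ m + f.natDegree := by
    rw [mem_support_iff, hcoeff] at hk
    by_contra! h
    apply hk
    rw [hzero h.1]
    split_ifs with hmk
    · rw [hzero (by have := h.2 hmk; omega), sub_zero]
    · rfl
  have hdeg : f.natDegree ∈ ((X ^ m - 1) * f).support := by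
    rw [mem_support_iff, hcoeff, if_neg (by omega)]
    simpa using hf
  have hmem : m ∈ ((X ^ m - 1) * f).support := by
    rw [mem_support_iff, hcoeff, if_pos le_rfl, hzero (by omega : f.natDegree < m)]
    simpa using h0
  refine maxGap_eq_of_forall_le hdeg hmem (by omega) (fun c hc => ?_) fun u hu v hv huv hc => ?_
  · have := hsupp hc
    omega
  · have := hsupp hu
    have := hsupp hv
    have := hc _ hdeg
    have := hc _ hmem
    omega

theorem invCyclotomic_eq_of_mul_eq {n : ℕ} {f : ℤ[X]} (h : X ^ n - 1 = f * cyclotomic n ℤ) :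
    invCyclotomic n = f := by
  rw [invCyclotomic, h, mul_comm]
  exact mul_divByMonic_cancel_left f (cyclotomic.monic n ℤ)

/-- If `m` is a proper divisor of `n` with `deg Ψₙ < 3m/2`, then `g(Ψₙ) = 2m - deg Ψₙ`. -/
theorem maxGap_invCyclotomic_of_mem_properDivisors {m n : ℕ} (hmn : m ∈ n.properDivisors)
    (hdeg : 2 * (invCyclotomic n).natDegree < 3 * m) :
    maxGap (invCyclotomic n) + (invCyclotomic n).natDegree = 2 * m := by
  obtain ⟨f, hf⟩ := X_pow_sub_one_mul_cyclotomic_dvd_X_pow_sub_one_of_dvd ℤ hmn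
  have hn : n ≠ 0 := by rintro rfl; simp at hmn
  have h0 : f.coeff 0 ≠ 0 := by
    intro h
    have := congrArg (coeff · 0) hf
    simp [mul_coeff_zero, h, hn.symm] at this
  rw [invCyclotomic_eq_of_mul_eq (f := (X ^ m - 1) * f) (by rw [hf]; ring)] at hdeg ⊢
  have hm : m ≠ 0 := by rintro rfl; simp at hdeg
  have hnat : ((X ^ m - 1) * f).natDegree = m + f.natDegree := by
    have hmonic : (X ^ m - 1 : ℤ[X]).Monic := monic_X_pow_sub_C 1 hm
    rw [hmonic.natDegree_mul' (by rintro rfl; simp at h0), ← C_1, natDegree_X_pow_sub_C]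
  rw [hnat] at hdeg ⊢
  rw [maxGap_X_pow_sub_one_mul h0 (by omega)]
  omega

theorem maxGap_invCyclotomic_of_D1 (p1 p2 p3 n : ℕ)
    (hp1 : p1.Prime) (hp2 : p2.Prime) (hp3 : p3.Prime)
    (hodd1 : Odd p1) (hodd2 : Odd p2) (hodd3 : Odd p3)
    (h12 : p1 < p2) (h23 : p2 < p3) (hn : n = p1 * p2 * p3)
    (hD1 : 4 * (invCyclotomic n).natDegree < 6 * p2 * p3) :
    (maxGap (invCyclotomic n) : ℤ) =
      2 * p2 * p3 - (invCyclotomic n).natDegree := by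
  have hmem : p2 * p3 ∈ n.properDivisors := by
    rw [Nat.mem_properDivisors, hn, mul_assoc]
    exact ⟨dvd_mul_left _ _, lt_mul_left (Nat.mul_pos hp2.pos hp3.pos) hp1.one_lt⟩
  have h := maxGap_invCyclotomic_of_mem_properDivisors hmem (by linarith)
  zify at h
  linarith
end
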